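/- arXiv:1808.00261 — 6 statements merged into one kernel-verified Lean document; each statement's English description precedes it below -/
import Mathlib

section
/- Let G=(Q,Σ,δ,I,F) be an NFA and Σ_o ⊆ Σ a set of observable events. A pair (x,y) ∈ Q×Q is reachable in the composition G⫙G (i.e., (x,y) ∈ f(I×I,u) for some u ∈ Σ*) if and only if there exist words w₁,w₂ ∈ Σ* with P(w₁)=P(w₂) such that x ∈ δ(I,w₁) and y ∈ δ(I,w₂). -/
/-- One step of an NFA transition function on a set of states: δ(S,a) = ⋃_{q∈S} δ(q,a). -/
def dStep {Q A : Type*} (δ : Q → A → Set Q) (S : Set Q) (a : A) : Set Q := ⋃ q ∈ S, δ q a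

/-- Extension of the transition function to words: δ(S,ε)=S, δ(S,aw)=δ(δ(S,a),w). -/
def dRun {Q A : Type*} (δ : Q → A → Set Q) (S : Set Q) : List A → Set Q
  | [] => S
  | a :: w => dRun δ (dStep δ S a) w

open Classical in
/-- Natural projection to observable events: erases all unobservable letters. -/
noncomputable def proj {A : Type*} (obs : A → Prop) : List A → List A
  | [] => []
  | a :: w => if obs a then a :: proj obs w else proj obs w

open Classical in
/-- The transition function f of the composition G⫙G: observable events are synchronized,
unobservable events are interleaved. -/
noncomputable def compStep {Q A : Type*} (δ : Q → A → Set Q) (obs : A → Prop)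
    (s : Q × Q) (e : A) : Set (Q × Q) :=
  if obs e then δ s.1 e ×ˢ δ s.2 e
  else (δ s.1 e ×ˢ {s.2}) ∪ ({s.1} ×ˢ δ s.2 e)

theorem mem_dRun_iff_exists {Q A : Type*} (δ : Q → A → Set Q) (S : Set Q) (w : List A) (x : Q) :
    x ∈ dRun δ S w ↔ ∃ p ∈ S, x ∈ dRun δ {p} w := by
  induction w generalizing S with
  | nil => simp [dRun]
  | cons a w ih =>
    simp only [dRun]
    rw [ih]
    constructor
    · rintro ⟨r, hr, hx⟩
      simp only [dStep, Set.mem_iUnion] at hr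
      obtain ⟨p, hp, hr⟩ := hr
      exact ⟨p, hp, (ih _).2 ⟨r, by simpa [dStep] using hr, hx⟩⟩
    · rintro ⟨p, hp, hx⟩
      obtain ⟨r, hr, hx⟩ := (ih _).1 hx
      refine ⟨r, ?_, hx⟩
      simp only [dStep, Set.mem_iUnion]
      exact ⟨p, hp, by simpa [dStep] using hr⟩

theorem mem_dRun_singleton_cons {Q A : Type*} (δ : Q → A → Set Q) (p : Q) (a : A) (w : List A)
    (x : Q) : x ∈ dRun δ {p} (a :: w) ↔ ∃ r ∈ δ p a, x ∈ dRun δ {r} w := by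
  rw [dRun, mem_dRun_iff_exists]
  simp [dStep]

theorem exists_words_of_mem_dRun_compStep {Q A : Type*} (δ : Q → A → Set Q) (obs : A → Prop)
    (x y : Q) (u : List A) (p q : Q) (h : (x, y) ∈ dRun (compStep δ obs) {(p, q)} u) :
    ∃ w₁ w₂ : List A, proj obs w₁ = proj obs w₂ ∧
      x ∈ dRun δ {p} w₁ ∧ y ∈ dRun δ {q} w₂ := by
  induction u generalizing p q with
  | nil =>
    obtain ⟨rfl, rfl⟩ : x = p ∧ y = q := by simpa [dRun] using h
    exact ⟨[], [], rfl, rfl, rfl⟩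
  | cons a u ih =>
    obtain ⟨⟨p', q'⟩, hr, h⟩ := (mem_dRun_singleton_cons _ _ _ _ _).1 h
    obtain ⟨w₁, w₂, hw, hx, hy⟩ := ih p' q' h
    by_cases ha : obs a
    · simp only [compStep, ha, if_true, Set.mem_prod] at hr
      exact ⟨a :: w₁, a :: w₂, by simp [proj, ha, hw],
        (mem_dRun_singleton_cons _ _ _ _ _).2 ⟨p', hr.1, hx⟩,
        (mem_dRun_singleton_cons _ _ _ _ _).2 ⟨q', hr.2, hy⟩⟩
    · simp only [compStep, ha, if_false, Set.mem_union, Set.mem_prod,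
        Set.mem_singleton_iff] at hr
      rcases hr with ⟨hp, rfl⟩ | ⟨rfl, hq⟩
      · exact ⟨a :: w₁, w₂, by simp [proj, ha, hw],
          (mem_dRun_singleton_cons _ _ _ _ _).2 ⟨p', hp, hx⟩, hy⟩
      · exact ⟨w₁, a :: w₂, by simp [proj, ha, hw], hx,
          (mem_dRun_singleton_cons _ _ _ _ _).2 ⟨q', hq, hy⟩⟩

theorem exists_mem_dRun_compStep_of_step {Q A : Type*} {δ : Q → A → Set Q} {obs : A → Prop}
    {s t z : Q × Q} {a : A} (hst : t ∈ compStep δ obs s a)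
    (h : ∃ u : List A, z ∈ dRun (compStep δ obs) {t} u) :
    ∃ u : List A, z ∈ dRun (compStep δ obs) {s} u := by
  obtain ⟨u, hu⟩ := h
  exact ⟨a :: u, (mem_dRun_singleton_cons _ _ _ _ _).2 ⟨t, hst, hu⟩⟩

theorem exists_mem_dRun_compStep_of_proj_eq {Q A : Type*} (δ : Q → A → Set Q) (obs : A → Prop)
    (x y : Q) (w₁ w₂ : List A) (p q : Q) (hw : proj obs w₁ = proj obs w₂)
    (hx : x ∈ dRun δ {p} w₁) (hy : y ∈ dRun δ {q} w₂) :
    ∃ u : List A, (x, y) ∈ dRun (compStep δ obs) {(p, q)} u := by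
  induction w₁ generalizing p q w₂ with
  | nil =>
    obtain rfl : x = p := by simpa [dRun] using hx
    induction w₂ generalizing q with
    | nil =>
      obtain rfl : y = q := by simpa [dRun] using hy
      exact ⟨[], rfl⟩
    | cons b w₂ ih =>
      obtain ⟨q', hq, hy⟩ := (mem_dRun_singleton_cons _ _ _ _ _).1 hy
      by_cases hb : obs b
      · simp [proj, hb] at hw
      · exact exists_mem_dRun_compStep_of_step (t := (x, q')) (a := b)
          (by simp [compStep, hb, hq]) (ih q' (by simpa [proj, hb] using hw) hy)
  | cons a w₁ ih =>
    by_cases ha : obs a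
    · obtain ⟨p', hp, hx⟩ := (mem_dRun_singleton_cons _ _ _ _ _).1 hx
      induction w₂ generalizing q with
      | nil => simp [proj, ha] at hw
      | cons b w₂ ih₂ =>
        obtain ⟨q', hq, hy'⟩ := (mem_dRun_singleton_cons _ _ _ _ _).1 hy
        by_cases hb : obs b
        · obtain ⟨rfl, htail⟩ : a = b ∧ proj obs w₁ = proj obs w₂ := by
            simpa [proj, ha, hb] using hw
          exact exists_mem_dRun_compStep_of_step (t := (p', q')) (a := a)
            (by simp [compStep, ha, hp, hq]) (ih w₂ p' q' htail hx hy')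
        · exact exists_mem_dRun_compStep_of_step (t := (p, q')) (a := b)
            (by simp [compStep, hb, hq]) (ih₂ q' (by simpa [proj, hb] using hw) hy')
    · obtain ⟨p', hp, hx⟩ := (mem_dRun_singleton_cons _ _ _ _ _).1 hx
      exact exists_mem_dRun_compStep_of_step (t := (p', q)) (a := a)
        (by simp [compStep, ha, hp]) (ih w₂ p' q (by simpa [proj, ha] using hw) hx hy)

/-- (x,y) is reachable in G⫙G iff there exist words w₁, w₂ with the same
projection such that x ∈ δ(I,w₁) and y ∈ δ(I,w₂). -/
theorem stmt1 {Q A : Type*} [Finite Q] [Finite A] (δ : Q → A → Set Q) (obs : A → Prop)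
    (I : Set Q) (F : Set Q) (hI : I.Nonempty) (x y : Q) :
    (∃ u : List A, (x, y) ∈ dRun (compStep δ obs) (I ×ˢ I) u) ↔
      ∃ w₁ w₂ : List A, proj obs w₁ = proj obs w₂ ∧ x ∈ dRun δ I w₁ ∧ y ∈ dRun δ I w₂ := by
  constructor
  · rintro ⟨u, hu⟩
    obtain ⟨⟨p, q⟩, ⟨hp, hq⟩, hu⟩ := (mem_dRun_iff_exists _ _ _ _).1 hu
    obtain ⟨w₁, w₂, hw, hx, hy⟩ := exists_words_of_mem_dRun_compStep δ obs x y u p q hu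
    exact ⟨w₁, w₂, hw, (mem_dRun_iff_exists _ _ _ _).2 ⟨p, hp, hx⟩,
      (mem_dRun_iff_exists _ _ _ _).2 ⟨q, hq, hy⟩⟩
  · rintro ⟨w₁, w₂, hw, hx, hy⟩
    obtain ⟨p, hp, hx⟩ := (mem_dRun_iff_exists _ _ _ _).1 hx
    obtain ⟨q, hq, hy⟩ := (mem_dRun_iff_exists _ _ _ _).1 hy
    obtain ⟨u, hu⟩ := exists_mem_dRun_compStep_of_proj_eq δ obs x y w₁ w₂ p q hw hx hy
    exact ⟨u, (mem_dRun_iff_exists _ _ _ _).2 ⟨(p, q), ⟨hp, hq⟩, hu⟩⟩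
end

section
/- Let D=(V,E) be a finite directed acyclic graph and s,t ∈ V. Define the NFA G=(Q,{a},δ,{s},Q) over the unary alphabet {a}, with all events observable, where Q = V ∪ {r} for a fresh state r ∉ V, and δ is given by: q ∈ δ(p,a) whenever (p,q) ∈ E, together with t ∈ δ(t,a) and r ∈ δ(t,a), and no other transitions. Then t is not reachable from s in D (i.e., there is no directed path from s to t) if and only if G is critically observable with respect to {a} and the critical set C = {t}. -/
/-- The state estimate δ(I,P⁻¹P(w)) = ⋃_{v : P(v)=P(w)} δ(I,v). -/
noncomputable def dEst {Q A : Type*} (δ : Q → A → Set Q) (obs : A → Prop) (I : Set Q)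
    (w : List A) : Set Q :=
  ⋃ v ∈ {v : List A | proj obs v = proj obs w}, dRun δ I v

/-- Critical observability of an NFA. -/
def CritObs {Q A : Type*} (δ : Q → A → Set Q) (obs : A → Prop) (I C : Set Q) : Prop :=
  ∀ w : List A, dRun δ I w ≠ ∅ → dEst δ obs I w ⊆ C ∨ dEst δ obs I w ⊆ Cᶜ

/-- The NFA of the NL-hardness reduction: states are `Option V` with `none` playing the
role of the fresh state r; the transitions under the single letter a are the edges of the
DAG together with t → t and t → r. -/
def dagNfa {V : Type*} (E : V → V → Prop) (t : V) : Option V → Unit → Set (Option V)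
  | some p, _ => {x | ∃ q, E p q ∧ x = some q} ∪ {x | p = t ∧ (x = some t ∨ x = none)}
  | none, _ => ∅

theorem dRun_append_singleton {Q A : Type*} (δ : Q → A → Set Q) (S : Set Q) (w : List A)
    (a : A) : dRun δ S (w ++ [a]) = dStep δ (dRun δ S w) a := by
  induction w generalizing S with
  | nil => rfl
  | cons b w ih => exact ih _

theorem mem_dStep {Q A : Type*} {δ : Q → A → Set Q} {S : Set Q} {a : A} {x : Q} :
    x ∈ dStep δ S a ↔ ∃ q ∈ S, x ∈ δ q a := by
  simp [dStep]

theorem dRun_subset_dEst {Q A : Type*} (δ : Q → A → Set Q) (obs : A → Prop) (I : Set Q)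
    (w : List A) : dRun δ I w ⊆ dEst δ obs I w :=
  Set.subset_biUnion_of_mem (u := dRun δ I) (show w ∈ {v | proj obs v = proj obs w} from rfl)

/-- Every reachable vertex of the graph is a state of the NFA reached by some word. -/
theorem exists_mem_dRun_dagNfa {V : Type*} {E : V → V → Prop} {s v : V} (t : V)
    (h : Relation.ReflTransGen E s v) :
    ∃ w : List Unit, some v ∈ dRun (dagNfa E t) {some s} w := by
  induction h with
  | refl => exact ⟨[], rfl⟩
  | tail _ hE ih =>
    obtain ⟨w, hw⟩ := ih
    refine ⟨w ++ [()], ?_⟩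
    rw [dRun_append_singleton, mem_dStep]
    exact ⟨_, hw, Or.inl ⟨_, hE, rfl⟩⟩

/-- Every non-fresh state reached by the NFA is a reachable vertex of the graph. -/
theorem reflTransGen_of_mem_dRun_dagNfa {V : Type*} {E : V → V → Prop} {s t v : V}
    {w : List Unit} (h : some v ∈ dRun (dagNfa E t) {some s} w) :
    Relation.ReflTransGen E s v := by
  induction w using List.reverseRecOn generalizing v with
  | nil =>
    obtain rfl : v = s := Option.some.inj h
    exact .refl
  | append_singleton w a ih =>
    rw [dRun_append_singleton, mem_dStep] at h
    obtain ⟨_ | p, hp, hv⟩ := h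
    · exact hv.elim
    · rcases hv with ⟨q, hE, hq⟩ | ⟨rfl, hv | hv⟩
      · cases hq
        exact (ih hp).tail hE
      · cases hv
        exact ih hp
      · cases hv

/-- t is not reachable from s in the finite DAG D=(V,E) iff the NFA G
(unary alphabet, full observation) is critically observable w.r.t. C = {t}. -/
theorem stmt3 {V : Type*} [Finite V] (E : V → V → Prop)
    (hacyc : ∀ v, ¬ Relation.TransGen E v v) (s t : V) :
    ¬ Relation.ReflTransGen E s t ↔
      CritObs (dagNfa E t) (fun _ : Unit => True) {some s} {some t} := by
  constructor
  · intro hst w _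
    right
    intro x hx hxt
    obtain rfl : x = some t := hxt
    obtain ⟨v, -, hv⟩ := Set.mem_iUnion₂.1 hx
    exact hst (reflTransGen_of_mem_dRun_dagNfa hv)
  · intro hC hst
    obtain ⟨w, hw⟩ := exists_mem_dRun_dagNfa t hst
    have mem {x : Option V} (hx : x = some t ∨ x = none) :
        x ∈ dRun (dagNfa E t) {some s} (w ++ [()]) := by
      rw [dRun_append_singleton, mem_dStep]
      exact ⟨_, hw, Or.inr ⟨rfl, hx⟩⟩
    have hsub := dRun_subset_dEst (dagNfa E t) (fun _ : Unit => True) {some s} (w ++ [()])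
    rcases hC (w ++ [()]) (Set.nonempty_iff_ne_empty.1 ⟨_, mem (.inl rfl)⟩) with h | h
    · exact Option.some_ne_none t (h (hsub (mem (.inr rfl)))).symm
    · exact h (hsub (mem (.inl rfl))) rfl
end

section
/- Let D=(V,E) be a finite directed acyclic graph and s,t ∈ V. Define the DFA G over the alphabet Σ = E ∪ {u}, where u ∉ E is a fresh unobservable event and every e ∈ E is observable (Σ_o = E), with state set Q = V ∪ {r} for a fresh state r ∉ V, single initial state s, and transitions: δ(p,(p,q)) = {q} for each edge (p,q) ∈ E, δ(t,u) = {r}, and no other transitions. Then t is not reachable from s in D if and only if G is critically observable with respect to Σ_o = E and the critical set C = {t}. -/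
/-- The DFA of the NL-hardness reduction with a single unobservable event:
states are `Option V` with `none` playing the role of the fresh state r; the alphabet is
`Option {e : V × V // E e.1 e.2}` — each edge of the DAG is its own (observable) event and
`none` is the fresh unobservable event u.  Transitions: δ(p,(p,q)) = {q} for every edge
(p,q) ∈ E, and δ(t,u) = {r}. -/
def dagDfa {V : Type*} [DecidableEq V] (E : V → V → Prop) (t : V) :
    Option V → Option {e : V × V // E e.1 e.2} → Set (Option V)
  | some p, some e => if e.val.1 = p then {some e.val.2} else ∅
  | some p, none => if p = t then {(none : Option V)} else ∅
  | none, _ => ∅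

theorem dRun_append {Q A : Type*} (δ : Q → A → Set Q) (S : Set Q) (v w : List A) :
    dRun δ S (v ++ w) = dRun δ (dRun δ S v) w := by
  induction v generalizing S with
  | nil => rfl
  | cons a v ih => exact ih _

theorem mem_dRun_append_singleton {Q A : Type*} {δ : Q → A → Set Q} {S : Set Q} {w : List A}
    {a : A} {p q : Q} (hp : p ∈ dRun δ S w) (hq : q ∈ δ p a) : q ∈ dRun δ S (w ++ [a]) := by
  rw [dRun_append]
  exact Set.mem_biUnion hp hq

theorem proj_append_singleton_of_not_obs {A : Type*} {obs : A → Prop} {a : A} (ha : ¬ obs a)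
    (w : List A) : proj obs (w ++ [a]) = proj obs w := by
  induction w with
  | nil => simp [proj, ha]
  | cons b w ih => simp [proj, ih]

theorem dRun_subset_of_closed {Q A : Type*} {δ : Q → A → Set Q} {T : Set Q}
    (hT : ∀ q ∈ T, ∀ a, δ q a ⊆ T) {S : Set Q} (hS : S ⊆ T) (w : List A) : dRun δ S w ⊆ T := by
  induction w generalizing S with
  | nil => exact hS
  | cons a w ih => exact ih (Set.iUnion₂_subset fun q hq => hT q (hS hq) a)

theorem exists_mem_dRun_dagDfa {V : Type*} [DecidableEq V] {E : V → V → Prop} (t : V) {s p : V}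
    (h : Relation.ReflTransGen E s p) : ∃ w, some p ∈ dRun (dagDfa E t) {some s} w := by
  induction h with
  | refl => exact ⟨[], rfl⟩
  | @tail b c _ hbc ih =>
    obtain ⟨w, hw⟩ := ih
    exact ⟨w ++ [some ⟨(b, c), hbc⟩], mem_dRun_append_singleton hw (by simp [dagDfa])⟩

theorem reflTransGen_of_mem_dRun_dagDfa {V : Type*} [DecidableEq V] {E : V → V → Prop}
    {s t p : V} {w : List (Option {e : V × V // E e.1 e.2})}
    (h : some p ∈ dRun (dagDfa E t) {some s} w) : Relation.ReflTransGen E s p := by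
  refine dRun_subset_of_closed (T := {x | ∀ q, x = some q → Relation.ReflTransGen E s q})
    ?_ ?_ w h p rfl
  · rintro (_ | q) hq (_ | ⟨⟨a, b⟩, hab⟩) x hx c rfl
    · simp [dagDfa] at hx
    · simp [dagDfa] at hx
    · simp [dagDfa] at hx
    · obtain ⟨rfl, rfl⟩ : a = q ∧ c = b := by simpa [dagDfa] using hx
      exact (hq a rfl).tail hab
  · rintro x rfl q hq
    cases hq
    exact .refl

/-- t is not reachable from s in the finite DAG D=(V,E) iff the DFA G
(edges observable, the single event u unobservable) is critically observable w.r.t. C = {t}. -/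
theorem stmt4 {V : Type*} [Finite V] [DecidableEq V] (E : V → V → Prop)
    (hacyc : ∀ v, ¬ Relation.TransGen E v v) (s t : V) :
    ¬ Relation.ReflTransGen E s t ↔
      CritObs (dagDfa E t) (fun a => a ≠ none) {some s} {some t} := by
  constructor
  · refine fun h w _ => Or.inr (Set.iUnion₂_subset fun v _ x hx hxt => h ?_)
    obtain rfl : x = some t := hxt
    exact reflTransGen_of_mem_dRun_dagDfa hx
  · intro hc h
    obtain ⟨w, hw⟩ := exists_mem_dRun_dagDfa t h
    rcases hc w (Set.nonempty_iff_ne_empty.mp ⟨_, hw⟩) with hsub | hsub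
    · have hnone : none ∈ dRun (dagDfa E t) {some s} (w ++ [none]) :=
        mem_dRun_append_singleton hw (by simp [dagDfa])
      have hmem : none ∈ ({some t} : Set (Option V)) :=
        hsub (Set.mem_biUnion (proj_append_singleton_of_not_obs (by simp) w) hnone)
      simp at hmem
    · exact hsub (Set.mem_biUnion (show proj _ w = proj _ w from rfl) hw) rfl
end

section
/- Let G₁,…,G_n be NFAs over the unary alphabet {a}, with all events observable, such that each G_i has at most k states, and let G = G₁ ∥ ⋯ ∥ G_n be their parallel composition with state set Q = Q₁×⋯×Q_n, initial states I, and transition function δ. If G is not critically observable with respect to a set C ⊆ Q, then there exists ℓ with 0 ≤ ℓ ≤ 2^{kn} such that δ(I,a^ℓ) ∩ C ≠ ∅ and δ(I,a^ℓ) ∖ C ≠ ∅. -/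
/-- The parallel composition of a family of NFAs over a common alphabet:
componentwise synchronized transitions. -/
def parStep {n : ℕ} {Q : Fin n → Type*} {A : Type*} (δ : ∀ i, Q i → A → Set (Q i)) :
    (∀ i, Q i) → A → Set (∀ i, Q i) :=
  fun s e => {s' | ∀ i, s' i ∈ δ i (s i) e}

/-- Every point on the orbit of `x` under a self-map of a finite type is reached in at most
`Nat.card X` steps. -/
theorem exists_iterate_eq_le_card {X : Type*} [Finite X] (f : X → X) (x : X) (m : ℕ) :
    ∃ l ≤ Nat.card X, f^[l] x = f^[m] x := by
  induction m using Nat.strong_induction_on with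
  | _ m ih =>
    rcases le_or_gt m (Nat.card X) with hm | hm
    · exact ⟨m, hm, rfl⟩
    · have hninj : ¬ Function.Injective (fun i : Fin m => f^[i] x) := fun hinj => by
        have := Nat.card_le_card_of_injective _ hinj
        rw [Nat.card_fin] at this
        omega
      have hrep : ∃ i j, i < j ∧ j < m ∧ f^[i] x = f^[j] x := by
        simp only [Function.Injective, not_forall] at hninj
        obtain ⟨a, b, hab, hne⟩ := hninj
        rcases lt_or_gt_of_ne hne with hlt | hlt
        · exact ⟨a, b, hlt, b.2, hab⟩
        · exact ⟨b, a, hlt, a.2, hab.symm⟩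
      obtain ⟨i, j, hij, hjm, he⟩ := hrep
      obtain ⟨l, hl, hlm⟩ := ih (m - j + i) (by omega)
      refine ⟨l, hl, hlm.trans ?_⟩
      rw [Function.iterate_add_apply, he, ← Function.iterate_add_apply,
        Nat.sub_add_cancel hjm.le]

theorem dStep_parStep {n : ℕ} {Q : Fin n → Type*} {A : Type*} (δ : ∀ i, Q i → A → Set (Q i))
    (S : ∀ i, Set (Q i)) (a : A) :
    dStep (parStep δ) {s | ∀ i, s i ∈ S i} a = {s | ∀ i, s i ∈ dStep (δ i) (S i) a} := by
  ext t
  simp only [dStep, parStep, Set.mem_iUnion, Set.mem_ofPred_eq, exists_prop]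
  constructor
  · rintro ⟨s, hs, ht⟩ i
    exact ⟨s i, hs i, ht i⟩
  · intro ht
    choose s hs hst using ht
    exact ⟨s, hs, hst⟩

theorem dRun_parStep_replicate {n : ℕ} {Q : Fin n → Type*} {A : Type*}
    (δ : ∀ i, Q i → A → Set (Q i)) (a : A) (m : ℕ) (S : ∀ i, Set (Q i)) :
    dRun (parStep δ) {s | ∀ i, s i ∈ S i} (List.replicate m a) =
      {s | ∀ i, s i ∈ (fun (T : ∀ i, Set (Q i)) i => dStep (δ i) (T i) a)^[m] S i} := by
  induction m generalizing S with
  | zero => rfl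
  | succ m ih =>
    rw [List.replicate_succ, dRun, dStep_parStep, ih]
    rfl

theorem proj_of_forall {A : Type*} {obs : A → Prop} (h : ∀ a, obs a) (w : List A) :
    proj obs w = w := by
  induction w with
  | nil => rfl
  | cons a w ih => rw [proj, if_pos (h a), ih]

theorem dEst_of_forall {Q A : Type*} (δ : Q → A → Set Q) {obs : A → Prop} (h : ∀ a, obs a)
    (I : Set Q) (w : List A) : dEst δ obs I w = dRun δ I w := by
  simp [dEst, proj_of_forall h]

theorem card_pi_set_le {n k : ℕ} (Q : Fin n → Type*) [∀ i, Finite (Q i)]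
    (hk : ∀ i, Nat.card (Q i) ≤ k) : Nat.card (∀ i, Set (Q i)) ≤ 2 ^ (k * n) := by
  have hset (i : Fin n) : Nat.card (Set (Q i)) ≤ 2 ^ k := by
    have := Fintype.ofFinite (Q i)
    rw [Nat.card_eq_fintype_card, Fintype.card_set, ← Nat.card_eq_fintype_card]
    exact Nat.pow_le_pow_right two_pos (hk i)
  calc Nat.card (∀ i, Set (Q i)) = ∏ i, Nat.card (Set (Q i)) := Nat.card_pi
    _ ≤ ∏ _i : Fin n, 2 ^ k := Finset.prod_le_prod' fun i _ => hset i
    _ = 2 ^ (k * n) := by simp [pow_mul]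

/-- if a parallel composition of n unary NFAs (full observation), each with
at most k states, is not critically observable w.r.t. C, then some word a^ℓ with
0 ≤ ℓ ≤ 2^{kn} leads the composition to a set of states containing both a critical and a
non-critical state. -/
theorem stmt8 (n k : ℕ) (Q : Fin n → Type*) [∀ i, Finite (Q i)]
    (hk : ∀ i, Nat.card (Q i) ≤ k)
    (δ : ∀ i, Q i → Unit → Set (Q i)) (I : ∀ i, Set (Q i)) (hI : ∀ i, (I i).Nonempty)
    (C : Set (∀ i, Q i))
    (h : ¬ CritObs (parStep δ) (fun _ : Unit => True) {s | ∀ i, s i ∈ I i} C) :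
    ∃ l ≤ 2 ^ (k * n),
      (dRun (parStep δ) {s | ∀ i, s i ∈ I i} (List.replicate l ()) ∩ C).Nonempty ∧
      (dRun (parStep δ) {s | ∀ i, s i ∈ I i} (List.replicate l ()) \ C).Nonempty := by
  simp only [CritObs, not_forall, not_or] at h
  obtain ⟨w, -, hC, hCc⟩ := h
  rw [dEst_of_forall _ fun _ => trivial] at hC hCc
  obtain ⟨m, rfl⟩ : ∃ m, w = List.replicate m () :=
    ⟨w.length, List.eq_replicate_iff.2 ⟨rfl, fun _ _ => rfl⟩⟩
  obtain ⟨l, hl, he⟩ := exists_iterate_eq_le_card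
    (fun (T : ∀ i, Set (Q i)) i => dStep (δ i) (T i) ()) I m
  refine ⟨l, hl.trans (card_pi_set_le Q hk), ?_⟩
  rw [dRun_parStep_replicate, he, ← dRun_parStep_replicate]
  rw [Set.subset_compl_iff_disjoint_right, Set.not_disjoint_iff_nonempty_inter] at hCc
  exact ⟨hCc, Set.sdiff_nonempty.2 hC⟩
end

section
/- Let G=(N,M₀,Σ,ℓ) be a labeled Petri net system with N=(P,T,Pre,Post), and let C be a set of markings. Let (N∥,M₀∥) be the label-based synchronization of G with its place-disjoint copy. Then G is not critically observable with respect to C if and only if there is a reachable marking M of (N∥,M₀∥) such that the restriction M(P) of M to the places P belongs to C and the restriction M(P') of M to the copy places P' (read as a marking of P via p ↦ M(p')) does not belong to C. -/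
/-- Transition t is enabled at marking M. -/
def enabled {P T : Type*} (Pre : P → T → ℕ) (M : P → ℕ) (t : T) : Prop :=
  ∀ p, Pre p t ≤ M p

/-- Firing transition t at marking M. -/
def fire {P T : Type*} (Pre Post : P → T → ℕ) (M : P → ℕ) (t : T) : P → ℕ :=
  fun p => M p - Pre p t + Post p t

/-- M →σ M': the transition sequence σ is enabled at M and its firing yields M'. -/
def fires {P T : Type*} (Pre Post : P → T → ℕ) : (P → ℕ) → List T → (P → ℕ) → Prop
  | M, [], M' => M' = M
  | M, t :: σ, M' => enabled Pre M t ∧ fires Pre Post (fire Pre Post M t) σ M'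

/-- The reachability set R(G): all markings reachable from M0. -/
def RG {P T : Type*} (Pre Post : P → T → ℕ) (M0 : P → ℕ) : Set (P → ℕ) :=
  {M | ∃ σ : List T, fires Pre Post M0 σ M}

/-- R(G,w): all markings reachable from M0 by a firing sequence with observation w,
where the labeling `lab : T → Option A` sends unobservable transitions to `none`. -/
def RGs {P T A : Type*} (Pre Post : P → T → ℕ) (M0 : P → ℕ) (lab : T → Option A)
    (w : List A) : Set (P → ℕ) :=
  {M | ∃ σ : List T, σ.filterMap lab = w ∧ fires Pre Post M0 σ M}

/-- Critical observability of a labeled Petri net system w.r.t. a set C of critical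
markings: for every observation w, either R(G,w) ⊆ C or R(G,w) ⊆ R(G)∖C. -/
def CritObsPN {P T A : Type*} (Pre Post : P → T → ℕ) (M0 : P → ℕ) (lab : T → Option A)
    (C : Set (P → ℕ)) : Prop :=
  ∀ w : List A, RGs Pre Post M0 lab w ⊆ C ∨ RGs Pre Post M0 lab w ⊆ RG Pre Post M0 \ C

/-- The transitions of the label-based synchronization N∥: pairs (t,λ) and (λ,t) for
unobservable t, and pairs (t₁,t₂) of equally-labeled observable transitions;
λ is modeled by `none`. -/
def SyncT {T A : Type*} (lab : T → Option A) : Set (Option T × Option T) :=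
  {tp | (∃ t, tp = (some t, none) ∧ lab t = none) ∨
        (∃ t, tp = (none, some t) ∧ lab t = none) ∨
        (∃ t₁ t₂ a, tp = (some t₁, some t₂) ∧ lab t₁ = some a ∧ lab t₂ = some a)}

/-- Arcs of the synchronization: the first component acts on the original places
(`Sum.inl`), the second on the copy places (`Sum.inr`); λ = `none` has no arcs. -/
def syncArc {P T : Type*} (W : P → T → ℕ) : (P ⊕ P) → (Option T × Option T) → ℕ
  | Sum.inl p, (some t, _) => W p t
  | Sum.inl _, (none, _) => 0
  | Sum.inr p, (_, some t) => W p t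
  | Sum.inr _, (_, none) => 0

section Synchronization

variable {P T A : Type*} {Pre Post : P → T → ℕ} {lab : T → Option A}

/-- The firing relation of the label-based synchronization. -/
abbrev syncFires (Pre Post : P → T → ℕ) (lab : T → Option A) :
    (P ⊕ P → ℕ) → List ↥(SyncT lab) → (P ⊕ P → ℕ) → Prop :=
  fires (fun pp (tp : ↥(SyncT lab)) => syncArc Pre pp tp.val)
    (fun pp tp => syncArc Post pp tp.val)

theorem syncFires_cons_left {t : T} (h : (some t, none) ∈ SyncT lab) {M₁ M₂ : P → ℕ}
    {σ : List ↥(SyncT lab)} {M' : P ⊕ P → ℕ} :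
    syncFires Pre Post lab (Sum.elim M₁ M₂) (⟨(some t, none), h⟩ :: σ) M' ↔
      enabled Pre M₁ t ∧ syncFires Pre Post lab (Sum.elim (fire Pre Post M₁ t) M₂) σ M' := by
  refine and_congr (by simp [enabled, syncArc]) (iff_of_eq ?_)
  congr 1
  funext pp
  cases pp <;> simp [fire, syncArc]

theorem syncFires_cons_right {t : T} (h : (none, some t) ∈ SyncT lab) {M₁ M₂ : P → ℕ}
    {σ : List ↥(SyncT lab)} {M' : P ⊕ P → ℕ} :
    syncFires Pre Post lab (Sum.elim M₁ M₂) (⟨(none, some t), h⟩ :: σ) M' ↔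
      enabled Pre M₂ t ∧ syncFires Pre Post lab (Sum.elim M₁ (fire Pre Post M₂ t)) σ M' := by
  refine and_congr (by simp [enabled, syncArc]) (iff_of_eq ?_)
  congr 1
  funext pp
  cases pp <;> simp [fire, syncArc]

theorem syncFires_cons_both {t₁ t₂ : T} (h : (some t₁, some t₂) ∈ SyncT lab) {M₁ M₂ : P → ℕ}
    {σ : List ↥(SyncT lab)} {M' : P ⊕ P → ℕ} :
    syncFires Pre Post lab (Sum.elim M₁ M₂) (⟨(some t₁, some t₂), h⟩ :: σ) M' ↔
      (enabled Pre M₁ t₁ ∧ enabled Pre M₂ t₂) ∧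
        syncFires Pre Post lab (Sum.elim (fire Pre Post M₁ t₁) (fire Pre Post M₂ t₂)) σ M' := by
  refine and_congr (by simp [enabled, syncArc]) (iff_of_eq ?_)
  congr 1
  funext pp
  cases pp <;> simp [fire, syncArc]

/-- A run of the synchronization projects to two runs with the same observation. -/
theorem exists_fires_of_syncFires {σ : List ↥(SyncT lab)} {M₁ M₂ : P → ℕ} {M' : P ⊕ P → ℕ}
    (h : syncFires Pre Post lab (Sum.elim M₁ M₂) σ M') :
    ∃ σ₁ σ₂ : List T, σ₁.filterMap lab = σ₂.filterMap lab ∧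
      fires Pre Post M₁ σ₁ (fun p => M' (Sum.inl p)) ∧
      fires Pre Post M₂ σ₂ (fun p => M' (Sum.inr p)) := by
  induction σ generalizing M₁ M₂ with
  | nil =>
    obtain rfl : M' = Sum.elim M₁ M₂ := h
    exact ⟨[], [], rfl, rfl, rfl⟩
  | cons tp σ ih =>
    obtain ⟨tp, htp⟩ := tp
    obtain ⟨t, rfl, ht⟩ | ⟨t, rfl, ht⟩ | ⟨t₁, t₂, a, rfl, h₁, h₂⟩ := id htp
    · obtain ⟨he, hf⟩ := (syncFires_cons_left htp).1 h
      obtain ⟨σ₁, σ₂, hσ, hf₁, hf₂⟩ := ih hf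
      exact ⟨t :: σ₁, σ₂, by rw [List.filterMap_cons_none ht, hσ], ⟨he, hf₁⟩, hf₂⟩
    · obtain ⟨he, hf⟩ := (syncFires_cons_right htp).1 h
      obtain ⟨σ₁, σ₂, hσ, hf₁, hf₂⟩ := ih hf
      exact ⟨σ₁, t :: σ₂, by rw [List.filterMap_cons_none ht, hσ], hf₁, ⟨he, hf₂⟩⟩
    · obtain ⟨⟨he₁, he₂⟩, hf⟩ := (syncFires_cons_both htp).1 h
      obtain ⟨σ₁, σ₂, hσ, hf₁, hf₂⟩ := ih hf
      exact ⟨t₁ :: σ₁, t₂ :: σ₂,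
        by rw [List.filterMap_cons_some h₁, List.filterMap_cons_some h₂, hσ],
        ⟨he₁, hf₁⟩, ⟨he₂, hf₂⟩⟩

/-- Two runs with the same observation combine to a run of the synchronization. -/
theorem exists_syncFires_of_fires {σ₁ σ₂ : List T} {M₁ M₂ M₁' M₂' : P → ℕ}
    (hσ : σ₁.filterMap lab = σ₂.filterMap lab)
    (h₁ : fires Pre Post M₁ σ₁ M₁') (h₂ : fires Pre Post M₂ σ₂ M₂') :
    ∃ σ : List ↥(SyncT lab),
      syncFires Pre Post lab (Sum.elim M₁ M₂) σ (Sum.elim M₁' M₂') := by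
  induction σ₁ generalizing M₁ M₂ σ₂ with
  | nil =>
    obtain rfl : M₁' = M₁ := h₁
    induction σ₂ generalizing M₂ with
    | nil =>
      obtain rfl : M₂' = M₂ := h₂
      exact ⟨[], rfl⟩
    | cons t σ₂ ih =>
      cases ht : lab t with
      | some a => simp [List.filterMap_cons_some ht] at hσ
      | none =>
        rw [List.filterMap_cons_none ht] at hσ
        obtain ⟨σ, hf⟩ := ih hσ h₂.2
        exact ⟨⟨(none, some t), .inr (.inl ⟨t, rfl, ht⟩)⟩ :: σ,
          (syncFires_cons_right _).2 ⟨h₂.1, hf⟩⟩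
  | cons t₁ σ₁ ih₁ =>
    cases ht₁ : lab t₁ with
    | none =>
      rw [List.filterMap_cons_none ht₁] at hσ
      obtain ⟨σ, hf⟩ := ih₁ hσ h₁.2 h₂
      exact ⟨⟨(some t₁, none), .inl ⟨t₁, rfl, ht₁⟩⟩ :: σ,
        (syncFires_cons_left _).2 ⟨h₁.1, hf⟩⟩
    | some a =>
      induction σ₂ generalizing M₂ with
      | nil => simp [List.filterMap_cons_some ht₁] at hσ
      | cons t₂ σ₂ ih₂ =>
        cases ht₂ : lab t₂ with
        | none =>
          rw [List.filterMap_cons_none ht₂] at hσ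
          obtain ⟨σ, hf⟩ := ih₂ hσ h₂.2
          exact ⟨⟨(none, some t₂), .inr (.inl ⟨t₂, rfl, ht₂⟩)⟩ :: σ,
            (syncFires_cons_right _).2 ⟨h₂.1, hf⟩⟩
        | some b =>
          rw [List.filterMap_cons_some ht₁, List.filterMap_cons_some ht₂, List.cons.injEq] at hσ
          obtain ⟨rfl, hσ⟩ := hσ
          obtain ⟨σ, hf⟩ := ih₁ hσ h₁.2 h₂.2
          exact ⟨⟨(some t₁, some t₂), .inr (.inr ⟨t₁, t₂, a, rfl, ht₁, ht₂⟩)⟩ :: σ,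
            (syncFires_cons_both _).2 ⟨⟨h₁.1, h₂.1⟩, hf⟩⟩

end Synchronization

/-- a labeled Petri net G is not critically observable w.r.t. C iff the
synchronization (N∥,M0∥) has a reachable marking M with M(P) ∈ C and M(P') ∉ C. -/
theorem stmt10 {P T A : Type*} [Finite P] [Finite T] (Pre Post : P → T → ℕ) (M0 : P → ℕ)
    (lab : T → Option A) (C : Set (P → ℕ)) :
    ¬ CritObsPN Pre Post M0 lab C ↔
      ∃ M ∈ RG (fun pp (tp : ↥(SyncT lab)) => syncArc Pre pp tp.val)
               (fun pp tp => syncArc Post pp tp.val) (Sum.elim M0 M0),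
        (fun p => M (Sum.inl p)) ∈ C ∧ (fun p => M (Sum.inr p)) ∉ C := by
  constructor
  · intro h
    simp only [CritObsPN, not_forall, not_or, Set.not_subset] at h
    obtain ⟨w, ⟨M₂, ⟨σ₂, hw₂, hf₂⟩, hM₂⟩, M₁, ⟨σ₁, hw₁, hf₁⟩, hM₁⟩ := h
    obtain ⟨σ, hf⟩ := exists_syncFires_of_fires (hw₁.trans hw₂.symm) hf₁ hf₂
    exact ⟨_, ⟨σ, hf⟩, by_contra fun hC => hM₁ ⟨⟨σ₁, hf₁⟩, hC⟩, hM₂⟩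
  · rintro ⟨M, ⟨σ, hf⟩, hC₁, hC₂⟩ h
    obtain ⟨σ₁, σ₂, hσ, hf₁, hf₂⟩ := exists_fires_of_syncFires hf
    obtain h | h := h (σ₂.filterMap lab)
    · exact hC₂ (h ⟨σ₂, rfl, hf₂⟩)
    · exact (h ⟨σ₁, hσ, hf₁⟩).2 hC₁
end

section
/- Let (N,M₀) be a Petri net system with N=(P,T,Pre,Post) and let M be a marking of N. Construct the labeled Petri net system G as follows: add a fresh place p' and a fresh transition t' with Pre-arcs 0 everywhere, Post(p',t')=1, and Post(p,t')=0 for p∈P; the labeling ℓ : T∪{t'} → T∪{ε} is ℓ(t)=t for t∈T (each original transition is its own observable label) and ℓ(t')=ε; the initial marking of G is M₀×(0) (agreeing with M₀ on P and putting 0 in p'). Then M is reachable in (N,M₀) if and only if G is not critically observable with respect to the critical set C = {M×(0)}, where M×(0) agrees with M on P and puts 0 tokens in p'. -/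
/-- Pre-incidence of the net G of the reduction: places `Option P` (with `none` the fresh
place p') and transitions `Option T` (with `none` the fresh transition t'); t' has no
pre-arcs and p' has no pre-arcs. -/
def redPre {P T : Type*} (Pre : P → T → ℕ) : Option P → Option T → ℕ
  | some p, some t => Pre p t
  | _, _ => 0

/-- Post-incidence of the net G of the reduction: the fresh transition t' puts one token
into the fresh place p' and nothing elsewhere. -/
def redPost {P T : Type*} (Post : P → T → ℕ) : Option P → Option T → ℕ
  | some p, some t => Post p t
  | none, none => 1
  | _, _ => 0

/-- Extension M×(c) of a marking M of P to `Option P`, putting c tokens into p'. -/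
def extMark {P : Type*} (M : P → ℕ) (c : ℕ) : Option P → ℕ
  | some p => M p
  | none => c

theorem enabled_redPre_some {P T : Type*} (Pre : P → T → ℕ) (M : P → ℕ) (c : ℕ) (t : T) :
    enabled (redPre Pre) (extMark M c) (some t) ↔ enabled Pre M t := by
  simp [enabled, Option.forall, redPre, extMark]

theorem enabled_redPre_none {P T : Type*} (Pre : P → T → ℕ) (M : P → ℕ) (c : ℕ) :
    enabled (redPre Pre) (extMark M c) none := by
  simp [enabled, redPre]

theorem fire_red_some {P T : Type*} (Pre Post : P → T → ℕ) (M : P → ℕ) (c : ℕ) (t : T) :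
    fire (redPre Pre) (redPost Post) (extMark M c) (some t) =
      extMark (fire Pre Post M t) c := by
  funext p
  cases p <;> simp [fire, redPre, redPost, extMark]

theorem fire_red_none {P T : Type*} (Pre Post : P → T → ℕ) (M : P → ℕ) (c : ℕ) :
    fire (redPre Pre) (redPost Post) (extMark M c) none = extMark M (c + 1) := by
  funext p
  cases p <;> simp [fire, redPre, redPost, extMark]

/-- Firing sequences of the extended net project onto those of the original net, and the
fresh place counts the occurrences of the fresh transition. -/
theorem fires_red_iff {P T : Type*} (Pre Post : P → T → ℕ) (M : P → ℕ) (c : ℕ)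
    (σ : List (Option T)) (X : Option P → ℕ) :
    fires (redPre Pre) (redPost Post) (extMark M c) σ X ↔
      ∃ M', fires Pre Post M (σ.filterMap fun t => t) M' ∧
        X = extMark M' (c + σ.countP Option.isNone) := by
  induction σ generalizing M c with
  | nil => simp [fires]
  | cons t σ ih =>
    cases t with
    | none =>
      simp [fires, enabled_redPre_none, fire_red_none, ih, Nat.add_assoc, Nat.add_comm 1]
    | some t =>
      simp [fires, enabled_redPre_some, fire_red_some, ih, and_assoc]

theorem extMark_inj {P : Type*} {M M' : P → ℕ} {c c' : ℕ} :
    extMark M c = extMark M' c' ↔ M = M' ∧ c = c' := by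
  refine ⟨fun h => ⟨funext fun p => congrFun h (some p), congrFun h none⟩, ?_⟩
  rintro ⟨rfl, rfl⟩
  rfl

/-- A labeled net fails to be critically observable iff some observation is consistent with
both a critical and a noncritical marking. -/
theorem not_critObsPN_iff {P T A : Type*} (Pre Post : P → T → ℕ) (M0 : P → ℕ)
    (lab : T → Option A) (C : Set (P → ℕ)) :
    ¬ CritObsPN Pre Post M0 lab C ↔
      ∃ w, (∃ X ∈ RGs Pre Post M0 lab w, X ∉ C) ∧ ∃ Y ∈ RGs Pre Post M0 lab w, Y ∈ C := by
  have hsub (w : List A) : RGs Pre Post M0 lab w ⊆ RG Pre Post M0 := by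
    rintro X ⟨σ, -, hσ⟩
    exact ⟨σ, hσ⟩
  simp only [CritObsPN, not_forall, not_or, Set.not_subset]
  refine exists_congr fun w => and_congr_right fun _ => exists_congr fun Y => ?_
  refine and_congr_right fun hY => ?_
  simp [hsub w hY]

/-- a marking M is reachable in the Petri net (N,M0) iff the labeled Petri
net G — obtained by adding a fresh place p' and a fresh unobservable transition t'
producing a token in p', every original transition being its own observable label — is
not critically observable w.r.t. the critical set C = {M×(0)}. -/
theorem stmt11 {P T : Type*} [Finite P] [Finite T] (Pre Post : P → T → ℕ)
    (M0 M : P → ℕ) :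
    M ∈ RG Pre Post M0 ↔
      ¬ CritObsPN (redPre Pre) (redPost Post) (extMark M0 0)
        (fun t : Option T => t) {extMark M 0} := by
  rw [not_critObsPN_iff]
  constructor
  · rintro ⟨σ, hσ⟩
    have hproj : (σ.map some).filterMap (fun t : Option T => t) = σ := by
      simp [List.filterMap_map]
    have hcount : (σ.map some).countP Option.isNone = 0 := by
      simp [List.countP_eq_zero]
    refine ⟨σ, ⟨extMark M 1, ⟨none :: σ.map some, by simp, ?_⟩, ?_⟩,
      extMark M 0, ⟨σ.map some, hproj, ?_⟩, rfl⟩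
    · rw [fires_red_iff]
      exact ⟨M, by simpa [hproj] using hσ, by simp [hcount]⟩
    · simp [extMark_inj]
    · rw [fires_red_iff]
      exact ⟨M, by rwa [hproj], by simp [hcount]⟩
  · rintro ⟨w, -, Y, ⟨σ, -, hσ⟩, rfl⟩
    obtain ⟨M', hM', hY⟩ := (fires_red_iff Pre Post M0 0 σ _).mp hσ
    exact ⟨_, (extMark_inj.mp hY).1 ▸ hM'⟩
end
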